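/- arXiv:math/0502072 — 6 statements merged into one kernel-verified Lean document; each statement's English description precedes it below -/
import Mathlib

section
/- Let f : ℝ⁴ → ℝ be a smooth function which is biharmonic on all of ℝ⁴, i.e. Δ(Δf) = 0 everywhere, where Δ denotes the Laplacian (the sum of the second partial derivatives along the four coordinate directions). If f is bounded and all of its partial derivatives of first and second order are bounded on ℝ⁴, then f is constant. -/
open scoped Topology

/-- The `i`-th partial derivative of `f : ℝ⁴ → ℝ`. -/
noncomputable def pd (i : Fin 4) (f : EuclideanSpace ℝ (Fin 4) → ℝ) :
    EuclideanSpace ℝ (Fin 4) → ℝ :=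
  fun x => fderiv ℝ f x (EuclideanSpace.single i 1)

/-- The Laplacian of `f : ℝ⁴ → ℝ`: the sum of the second partial derivatives
along the four coordinate directions. -/
noncomputable def laplacian (f : EuclideanSpace ℝ (Fin 4) → ℝ) :
    EuclideanSpace ℝ (Fin 4) → ℝ :=
  fun x => ∑ i : Fin 4, pd i (pd i f) x

lemma deriv_deriv_nonpos_of_isLocalMax {h : ℝ → ℝ} (hh : ContDiff ℝ 2 h)
    (hmax : IsLocalMax h 0) : deriv (deriv h) 0 ≤ 0 := by
  by_contra! hpos
  have hmin : IsLocalMin h 0 :=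
    isLocalMin_of_deriv_deriv_pos hpos hmax.deriv_eq_zero hh.continuous.continuousAt
  have hconst : h =ᶠ[𝓝 0] fun _ => h 0 := by
    filter_upwards [hmax, hmin] with t h1 h2 using le_antisymm h1 h2
  have hzero : deriv (deriv h) 0 = 0 := by
    rw [hconst.deriv.deriv_eq]
    simp
  exact hpos.ne' hzero

lemma deriv_deriv_le_of_forall_le {k : ℝ → ℝ} (hk : ContDiff ℝ 2 k) {a ε : ℝ}
    (hle : ∀ t, k t ≤ k 0 + a * t + ε * t ^ 2) : deriv (deriv k) 0 ≤ 2 * ε := by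
  have hk1 : Differentiable ℝ k := hk.differentiable (by norm_num)
  have hk2 : Differentiable ℝ (deriv k) :=
    (((contDiff_succ_iff_deriv (n := 1)).1 hk).2.2).differentiable (by norm_num)
  have key := deriv_deriv_nonpos_of_isLocalMax (h := fun t => k t - (a * t + ε * t ^ 2))
    (by fun_prop) (Filter.Eventually.of_forall fun t => by have := hle t; simp; linarith)
  have h1 : deriv (fun t => k t - (a * t + ε * t ^ 2)) = fun t => deriv k t - (a + 2 * ε * t) := by
    ext t
    have h := (hk1 t).hasDerivAt.sub
      (((hasDerivAt_id t).const_mul a).add (((hasDerivAt_id t).pow 2).const_mul ε))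
    refine (h.congr_deriv ?_).deriv
    simp
    ring
  have h2 : deriv (fun t => deriv k t - (a + 2 * ε * t)) 0 = deriv (deriv k) 0 - 2 * ε := by
    have h := (hk2 0).hasDerivAt.sub (((hasDerivAt_id (0 : ℝ)).const_mul (2 * ε)).const_add a)
    refine (h.congr_deriv ?_).deriv
    simp
  rw [h1, h2] at key
  linarith

section PartialDerivatives

variable {f g : EuclideanSpace ℝ (Fin 4) → ℝ}

lemma ContDiff.pd (hf : ContDiff ℝ (⊤ : ℕ∞) f) (i : Fin 4) :
    ContDiff ℝ (⊤ : ℕ∞) (_root_.pd i f) :=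
  (hf.fderiv_right (m := (⊤ : ℕ∞)) (by simp)).clm_apply contDiff_const

lemma ContDiff.laplacian (hf : ContDiff ℝ (⊤ : ℕ∞) f) :
    ContDiff ℝ (⊤ : ℕ∞) (_root_.laplacian f) :=
  ContDiff.sum fun i _ => (hf.pd i).pd i

lemma pd_add (hf : ContDiff ℝ (⊤ : ℕ∞) f) (hg : ContDiff ℝ (⊤ : ℕ∞) g) (i : Fin 4) :
    pd i (fun x => f x + g x) = fun x => pd i f x + pd i g x := by
  ext x
  simp [pd, fderiv_fun_add (hf.differentiable (by simp) x) (hg.differentiable (by simp) x)]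

lemma pd_const_mul (hf : ContDiff ℝ (⊤ : ℕ∞) f) (c : ℝ) (i : Fin 4) :
    pd i (fun x => c * f x) = fun x => c * pd i f x := by
  ext x
  simp [pd, fderiv_const_mul (hf.differentiable (by simp) x)]

lemma pd_mul (hf : ContDiff ℝ (⊤ : ℕ∞) f) (hg : ContDiff ℝ (⊤ : ℕ∞) g) (i : Fin 4) :
    pd i (fun x => f x * g x) = fun x => f x * pd i g x + g x * pd i f x := by
  ext x
  simp [pd, fderiv_fun_mul (hf.differentiable (by simp) x) (hg.differentiable (by simp) x)]

lemma pd_comm (hf : ContDiff ℝ (⊤ : ℕ∞) f) (i j : Fin 4) :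
    pd i (pd j f) = pd j (pd i f) := by
  have hd : Differentiable ℝ (fderiv ℝ f) :=
    (hf.fderiv_right (m := (⊤ : ℕ∞)) (by simp)).differentiable (by simp)
  have hpd : ∀ (i j : Fin 4) x, pd i (pd j f) x =
      fderiv ℝ (fderiv ℝ f) x (EuclideanSpace.single i 1) (EuclideanSpace.single j 1) := by
    intro i j x
    change fderiv ℝ (fun y => fderiv ℝ f y (EuclideanSpace.single j 1)) x _ = _
    rw [fderiv_clm_apply (hd x) (differentiableAt_const _)]
    simp
  ext x
  rw [hpd, hpd]
  exact ((contDiff_infty.1 hf 2).contDiffAt.isSymmSndFDerivAt (by simp)) _ _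

lemma laplacian_add (hf : ContDiff ℝ (⊤ : ℕ∞) f) (hg : ContDiff ℝ (⊤ : ℕ∞) g)
    (x : EuclideanSpace ℝ (Fin 4)) :
    laplacian (fun x => f x + g x) x = laplacian f x + laplacian g x := by
  simp only [laplacian, ← Finset.sum_add_distrib]
  refine Finset.sum_congr rfl fun i _ => ?_
  rw [pd_add hf hg, pd_add (hf.pd i) (hg.pd i)]

lemma laplacian_const_mul (hf : ContDiff ℝ (⊤ : ℕ∞) f) (c : ℝ)
    (x : EuclideanSpace ℝ (Fin 4)) :
    laplacian (fun x => c * f x) x = c * laplacian f x := by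
  simp only [laplacian, Finset.mul_sum]
  refine Finset.sum_congr rfl fun i _ => ?_
  rw [pd_const_mul hf, pd_const_mul (hf.pd i)]

lemma laplacian_mul (hf : ContDiff ℝ (⊤ : ℕ∞) f) (hg : ContDiff ℝ (⊤ : ℕ∞) g)
    (x : EuclideanSpace ℝ (Fin 4)) :
    laplacian (fun x => f x * g x) x =
      f x * laplacian g x + g x * laplacian f x + 2 * ∑ i, pd i f x * pd i g x := by
  simp only [laplacian, Finset.mul_sum, ← Finset.sum_add_distrib]
  refine Finset.sum_congr rfl fun i _ => ?_
  rw [pd_mul hf hg, pd_add (hf.mul (hg.pd i)) (hg.mul (hf.pd i)), pd_mul hf (hg.pd i),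
    pd_mul hg (hf.pd i)]
  ring

lemma laplacian_pd (hf : ContDiff ℝ (⊤ : ℕ∞) f) (i : Fin 4) :
    laplacian (pd i f) = pd i (laplacian f) := by
  ext x
  have hsum : pd i (laplacian f) x = ∑ j, pd i (pd j (pd j f)) x := by
    unfold laplacian
    rw [pd, fderiv_fun_sum fun j _ => ((hf.pd j).pd j).differentiable (by simp) x]
    simp [pd]
  rw [hsum, laplacian]
  refine Finset.sum_congr rfl fun j _ => ?_
  rw [pd_comm hf j i, pd_comm (hf.pd j) j i]

lemma deriv_comp_line (hf : ContDiff ℝ (⊤ : ℕ∞) f) (y : EuclideanSpace ℝ (Fin 4)) (i : Fin 4) :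
    deriv (fun t : ℝ => f (y + t • EuclideanSpace.single i 1)) =
      fun t => pd i f (y + t • EuclideanSpace.single i 1) := by
  ext t
  have hline : HasDerivAt (fun t : ℝ => y + t • EuclideanSpace.single i (1 : ℝ))
      (EuclideanSpace.single i 1) t := by
    simpa using ((hasDerivAt_id t).smul_const (EuclideanSpace.single i (1 : ℝ))).const_add y
  exact ((hf.differentiable (by simp) _).hasFDerivAt.comp_hasDerivAt t hline).deriv

/-- A weak maximum principle at infinity. -/
lemma exists_le_and_laplacian_le {w : EuclideanSpace ℝ (Fin 4) → ℝ}
    (hw : ContDiff ℝ (⊤ : ℕ∞) w) {K : ℝ} (hK : ∀ x, w x ≤ K)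
    (x : EuclideanSpace ℝ (Fin 4)) {ε : ℝ} (hε : 0 < ε) :
    ∃ y, w x ≤ w y ∧ laplacian w y ≤ 8 * ε := by
  have htend : Filter.Tendsto (fun z => w z - ε * ‖z - x‖ ^ 2)
      (Filter.cocompact (EuclideanSpace ℝ (Fin 4))) Filter.atBot := by
    have h1 : Filter.Tendsto (fun z => ‖z - x‖)
        (Filter.cocompact (EuclideanSpace ℝ (Fin 4))) Filter.atTop := by
      simpa [dist_eq_norm] using tendsto_dist_right_cocompact_atTop x
    have h2 := ((Filter.tendsto_pow_atTop (two_ne_zero)).comp h1).const_mul_atTop hε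
    have h3 := Filter.tendsto_atBot_add_const_left _ K (Filter.tendsto_neg_atTop_atBot.comp h2)
    refine Filter.tendsto_atBot_mono (fun z => ?_) h3
    have := hK z
    simp only [Function.comp_apply]
    linarith
  have hwc := hw.continuous
  obtain ⟨y, hy⟩ := (show Continuous fun z => w z - ε * ‖z - x‖ ^ 2 by
    fun_prop).exists_forall_ge htend
  refine ⟨y, ?_, ?_⟩
  · have := hy x
    simp only [sub_self, norm_zero] at this
    nlinarith [sq_nonneg ‖y - x‖]
  · have hi : ∀ i : Fin 4, pd i (pd i w) y ≤ 2 * ε := by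
      intro i
      have hsmooth : ContDiff ℝ 2 (fun t : ℝ => w (y + t • EuclideanSpace.single i 1)) :=
        (contDiff_infty.1 hw 2).comp
          (contDiff_const.add (contDiff_id.smul contDiff_const))
      have h := deriv_deriv_le_of_forall_le hsmooth
        (a := ε * (2 * inner ℝ (y - x) (EuclideanSpace.single i 1))) (ε := ε) (fun t => by
          have h := hy (y + t • EuclideanSpace.single i 1)
          have he : y + t • EuclideanSpace.single i (1 : ℝ) - x =
              (y - x) + t • EuclideanSpace.single i 1 := by abel
          rw [he, norm_add_sq_real, norm_smul, inner_smul_right] at h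
          simp only [PiLp.norm_single, norm_one, mul_one, Real.norm_eq_abs,
            sq_abs] at h
          simp only [zero_smul, add_zero]
          linarith)
      rw [deriv_comp_line hw, deriv_comp_line (hw.pd i)] at h
      simpa using h
    calc laplacian w y ≤ ∑ _i : Fin 4, 2 * ε := Finset.sum_le_sum fun i _ => hi i
      _ = 8 * ε := by simp; ring

/-- A bounded harmonic function with bounded partial derivatives has vanishing partial
derivatives. -/
lemma pd_eq_zero_of_harmonic (hf : ContDiff ℝ (⊤ : ℕ∞) f) (hharm : ∀ x, laplacian f x = 0)
    {M : ℝ} (hM : ∀ x, |f x| ≤ M) (i : Fin 4) {N : ℝ} (hN : ∀ x, |pd i f x| ≤ N)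
    (x : EuclideanSpace ℝ (Fin 4)) : pd i f x = 0 := by
  have hd := hf.pd i
  have hdharm : ∀ x, laplacian (pd i f) x = 0 := by
    intro x
    rw [laplacian_pd hf, funext hharm]
    simp [pd]
  have hfsq : ∀ x, f x * f x ≤ M ^ 2 := fun x => by
    rw [← sq, ← sq_abs]; exact pow_le_pow_left₀ (abs_nonneg _) (hM x) 2
  have hdsq : ∀ x, pd i f x * pd i f x ≤ N ^ 2 := fun x => by
    rw [← sq, ← sq_abs]; exact pow_le_pow_left₀ (abs_nonneg _) (hN x) 2
  have key : ∀ A : ℝ, 0 < A → pd i f x * pd i f x ≤ A * (4 + M ^ 2) := by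
    intro A hA
    obtain ⟨y, hxy, hy⟩ := exists_le_and_laplacian_le
      (w := fun x => pd i f x * pd i f x + A * (f x * f x))
      ((hd.mul hd).add (contDiff_const.mul (hf.mul hf))) (K := N ^ 2 + A * M ^ 2)
      (fun x => add_le_add (hdsq x) (mul_le_mul_of_nonneg_left (hfsq x) hA.le)) x
      (pow_pos hA 2)
    rw [laplacian_add (hd.mul hd) (contDiff_const.mul (hf.mul hf)),
      laplacian_const_mul (hf.mul hf), laplacian_mul hd hd, laplacian_mul hf hf,
      hharm, hdharm] at hy
    have h1 : 0 ≤ ∑ j, pd j (pd i f) y * pd j (pd i f) y :=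
      Finset.sum_nonneg fun j _ => mul_self_nonneg _
    have h2 : pd i f y * pd i f y ≤ ∑ j, pd j f y * pd j f y :=
      Finset.single_le_sum (f := fun j => pd j f y * pd j f y)
        (fun j _ => mul_self_nonneg _) (Finset.mem_univ i)
    have h3 : pd i f y * pd i f y ≤ 4 * A := by
      refine h2.trans (le_of_mul_le_mul_left ?_ hA)
      nlinarith
    have h4 := mul_le_mul_of_nonneg_left (hfsq y) hA.le
    have h5 : 0 ≤ A * (f x * f x) := mul_nonneg hA.le (mul_self_nonneg _)
    linarith
  refine mul_self_eq_zero.1 (le_antisymm ?_ (mul_self_nonneg _))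
  refine le_of_forall_pos_le_add fun δ hδ => ?_
  have h := key (δ / (4 + M ^ 2)) (by positivity)
  rwa [div_mul_cancel₀ _ (by positivity), ← zero_add δ] at h

/-- A bounded biharmonic function with bounded Laplacian is harmonic. -/
lemma laplacian_eq_zero_of_biharmonic (hf : ContDiff ℝ (⊤ : ℕ∞) f)
    (hbih : ∀ x, laplacian (laplacian f) x = 0) {M : ℝ} (hM0 : 0 < M) (hM : ∀ x, |f x| ≤ M)
    {G : ℝ} (hG : ∀ x, |laplacian f x| ≤ G) (x : EuclideanSpace ℝ (Fin 4)) :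
    laplacian f x = 0 := by
  set g := laplacian f with hg_def
  have hg : ContDiff ℝ (⊤ : ℕ∞) g := hf.laplacian
  have hG0 : 0 ≤ G := (abs_nonneg _).trans (hG x)
  have hgf : ∀ x, |g x * f x| ≤ |g x| * M := fun x => by
    rw [abs_mul]; exact mul_le_mul_of_nonneg_left (hM x) (abs_nonneg _)
  have hfsq : ∀ x, f x * f x ≤ M ^ 2 := fun x => by
    rw [← sq, ← sq_abs]; exact pow_le_pow_left₀ (abs_nonneg _) (hM x) 2
  have hgsq : ∀ x, g x * g x ≤ G ^ 2 := fun x => by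
    rw [← sq, ← sq_abs]; exact pow_le_pow_left₀ (abs_nonneg _) (hG x) 2
  have key : ∀ A B : ℝ, 0 < A → 0 < B → 4 * A * B = 1 →
      A * (g x * g x) ≤ G * M + 7 * B * M ^ 2 := by
    intro A B hA hB hAB
    have hs1 := hg.mul hf
    have hs2 := hg.mul hg
    have hs3 := hf.mul hf
    obtain ⟨y, hxy, hy⟩ := exists_le_and_laplacian_le
      (w := fun x => g x * f x + (A * (g x * g x) + B * (f x * f x)))
      (hs1.add ((contDiff_const.mul hs2).add (contDiff_const.mul hs3)))
      (K := G * M + (A * G ^ 2 + B * M ^ 2))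
      (fun x => add_le_add
        ((le_abs_self _).trans ((hgf x).trans (mul_le_mul_of_nonneg_right (hG x) hM0.le)))
        (add_le_add (mul_le_mul_of_nonneg_left (hgsq x) hA.le)
          (mul_le_mul_of_nonneg_left (hfsq x) hB.le))) x
      (ε := (B * M) ^ 2 / 4) (by positivity)
    rw [laplacian_add hs1 ((contDiff_const.mul hs2).add (contDiff_const.mul hs3)),
      laplacian_add (contDiff_const.mul hs2) (contDiff_const.mul hs3),
      laplacian_const_mul hs2, laplacian_const_mul hs3, laplacian_mul hg hf,
      laplacian_mul hg hg, laplacian_mul hf hf, hbih, ← hg_def] at hy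
    have hsq : 0 ≤ ∑ i, pd i g y * pd i f y + A * ∑ i, pd i g y * pd i g y
        + B * ∑ i, pd i f y * pd i f y := by
      simp only [Finset.mul_sum, ← Finset.sum_add_distrib]
      refine Finset.sum_nonneg fun i _ => ?_
      have h : 0 ≤ A * (pd i g y + 2 * B * pd i f y) ^ 2 := by positivity
      have h' : A * (pd i g y + 2 * B * pd i f y) ^ 2 = A * (pd i g y * pd i g y)
          + (4 * A * B) * (pd i g y * pd i f y)
          + (4 * A * B) * (B * (pd i f y * pd i f y)) := by ring
      rw [hAB] at h'
      linarith
    have hB2 := mul_le_mul_of_nonneg_left (hfsq y) (sq_nonneg B)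
    have hgy : |g y| ≤ 3 * B * M := by
      refine abs_le_of_sq_le_sq ?_ (by positivity)
      nlinarith [sq_nonneg (g y + 2 * B * f y)]
    have hgy2 : g y * g y ≤ (3 * B * M) ^ 2 := by
      rw [← sq, ← sq_abs]; exact pow_le_pow_left₀ (abs_nonneg _) hgy 2
    have h1 : g y * f y ≤ 3 * B * M * M :=
      (le_abs_self _).trans ((hgf y).trans (mul_le_mul_of_nonneg_right hgy hM0.le))
    have h2 : A * (g y * g y) ≤ 9 / 4 * B * M ^ 2 := by
      refine (mul_le_mul_of_nonneg_left hgy2 hA.le).trans_eq ?_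
      linear_combination (9 / 4 * B * M ^ 2) * hAB
    have h3 := mul_le_mul_of_nonneg_left (hfsq y) hB.le
    have h4 : -(G * M) ≤ g x * f x :=
      neg_le_of_abs_le ((hgf x).trans (mul_le_mul_of_nonneg_right (hG x) hM0.le))
    have h5 : 0 ≤ B * (f x * f x) := mul_nonneg hB.le (mul_self_nonneg _)
    have h6 : 0 ≤ B * M ^ 2 := by positivity
    linarith
  have hlim : Filter.Tendsto (fun B : ℝ => 4 * B * (G * M + 7 * B * M ^ 2)) (𝓝[>] 0) (𝓝 0) := by
    have hc : Continuous fun B : ℝ => 4 * B * (G * M + 7 * B * M ^ 2) := by fun_prop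
    simpa using (hc.tendsto 0).mono_left nhdsWithin_le_nhds
  refine mul_self_eq_zero.1 (le_antisymm ?_ (mul_self_nonneg _))
  refine ge_of_tendsto hlim ?_
  filter_upwards [self_mem_nhdsWithin] with B (hB : 0 < B)
  have h := key (1 / (4 * B)) B (by positivity) hB (by field_simp)
  rwa [one_div_mul_eq_div, div_le_iff₀' (by positivity)] at h

end PartialDerivatives

/-- Liouville theorem for biharmonic functions: a smooth biharmonic function on ℝ⁴
which is bounded together with all its partial derivatives of first and second order
is constant. -/
theorem liouville_biharmonic (f : EuclideanSpace ℝ (Fin 4) → ℝ)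
    (hf : ContDiff ℝ (⊤ : ℕ∞) f)
    (hbih : ∀ x, laplacian (laplacian f) x = 0)
    (hb : ∃ C : ℝ, ∀ x, |f x| ≤ C)
    (hb1 : ∀ i : Fin 4, ∃ C : ℝ, ∀ x, |pd i f x| ≤ C)
    (hb2 : ∀ i j : Fin 4, ∃ C : ℝ, ∀ x, |pd i (pd j f) x| ≤ C) :
    ∀ x y, f x = f y := by
  obtain ⟨C, hC⟩ := hb
  have hM : ∀ x, |f x| ≤ C ⊔ 1 := fun x => (hC x).trans le_sup_left
  choose D hD using hb1
  choose E hE using fun i => hb2 i i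
  have hG : ∀ x, |laplacian f x| ≤ ∑ i, E i := fun x =>
    (Finset.abs_sum_le_sum_abs _ _).trans (Finset.sum_le_sum fun i _ => hE i x)
  have hharm := laplacian_eq_zero_of_biharmonic hf hbih (by positivity) hM hG
  refine is_const_of_fderiv_eq_zero (𝕜 := ℝ) (hf.differentiable (by simp)) fun x => ?_
  refine ContinuousLinearMap.coe_injective
    ((EuclideanSpace.basisFun (Fin 4) ℝ).toBasis.ext fun i => ?_)
  simpa [pd] using pd_eq_zero_of_harmonic hf hharm hM i (hD i) x
end

section
/- Let Q be the quadratic form on ℝ³ given by Q(v) = −‖v‖², let C = CliffordAlgebra Q, and let P ⊆ C be the submodule of paravectors, i.e. the sum of the line spanned by 1 and the image of the canonical embedding ι : ℝ³ → C. Then for all h, x ∈ P and every n ∈ ℕ, the element (h·x)ⁿ·h belongs to P. In particular h·x·h ∈ P. -/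
/-- The submodule of paravectors `S ⊕ V` in the Clifford algebra `ℝ_{0,3}`:
the sum of the scalar line `ℝ·1` and of the image of `ι : ℝ³ → CliffordAlgebra Q`. -/
noncomputable def paravectors (Q : QuadraticForm ℝ (EuclideanSpace ℝ (Fin 3))) :
    Submodule ℝ (CliffordAlgebra Q) :=
  Submodule.span ℝ {1} ⊔ LinearMap.range (CliffordAlgebra.ι Q)

theorem mem_paravectors_iff {Q : QuadraticForm ℝ (EuclideanSpace ℝ (Fin 3))}
    {p : CliffordAlgebra Q} :
    p ∈ paravectors Q ↔
      ∃ (a : ℝ) (u : EuclideanSpace ℝ (Fin 3)),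
        p = algebraMap ℝ (CliffordAlgebra Q) a + CliffordAlgebra.ι Q u := by
  simp only [paravectors, Submodule.mem_sup, Submodule.mem_span_singleton, LinearMap.mem_range,
    Algebra.algebraMap_eq_smul_one]
  constructor
  · rintro ⟨_, ⟨a, rfl⟩, _, ⟨u, rfl⟩, rfl⟩
    exact ⟨a, u, rfl⟩
  · rintro ⟨a, u, rfl⟩
    exact ⟨_, ⟨a, rfl⟩, _, ⟨u, rfl⟩, rfl⟩

/-- Paravectors are closed under the Jordan product. -/
theorem mul_add_swap_mem_paravectors {Q : QuadraticForm ℝ (EuclideanSpace ℝ (Fin 3))}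
    {p q : CliffordAlgebra Q} (hp : p ∈ paravectors Q) (hq : q ∈ paravectors Q) :
    p * q + q * p ∈ paravectors Q := by
  obtain ⟨a, u, rfl⟩ := mem_paravectors_iff.1 hp
  obtain ⟨b, v, rfl⟩ := mem_paravectors_iff.1 hq
  refine mem_paravectors_iff.2 ⟨2 * (a * b) + QuadraticMap.polar Q u v,
    (2 * a) • v + (2 * b) • u, ?_⟩
  rw [map_add, ← CliffordAlgebra.ι_mul_ι_add_swap]
  simp only [Algebra.algebraMap_eq_smul_one, map_add, map_smul, add_mul, mul_add, smul_mul_assoc,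
    mul_smul_comm, one_mul, mul_one]
  module

theorem mul_mul_self_mem_paravectors {Q : QuadraticForm ℝ (EuclideanSpace ℝ (Fin 3))}
    {p q : CliffordAlgebra Q} (hp : p ∈ paravectors Q) (hq : q ∈ paravectors Q) :
    p * q * p ∈ paravectors Q := by
  have hpp := mul_add_swap_mem_paravectors hp hp
  have key : p * q * p = (2⁻¹ : ℝ) • ((p * (p * q + q * p) + (p * q + q * p) * p) -
      (2⁻¹ : ℝ) • ((p * p + p * p) * q + q * (p * p + p * p))) := by
    simp only [mul_add, add_mul, mul_assoc]
    module
  rw [key]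
  exact Submodule.smul_mem _ _ (Submodule.sub_mem _
    (mul_add_swap_mem_paravectors hp (mul_add_swap_mem_paravectors hp hq))
    (Submodule.smul_mem _ _ (mul_add_swap_mem_paravectors hpp hq)))

/-- In the Clifford algebra `ℝ_{0,3}` of the quadratic form `Q v = -‖v‖²` on ℝ³, for
paravectors `h, x` and every `n ∈ ℕ`, the element `(h x)ⁿ h` is again a paravector;
in particular `h x h` is a paravector. -/
theorem pow_mul_mem_paravectors (Q : QuadraticForm ℝ (EuclideanSpace ℝ (Fin 3)))
    (hQ : ∀ v, Q v = -‖v‖ ^ 2) :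
    ∀ h x : CliffordAlgebra Q, h ∈ paravectors Q → x ∈ paravectors Q →
      (∀ n : ℕ, (h * x) ^ n * h ∈ paravectors Q) ∧ h * x * h ∈ paravectors Q := by
  intro h x hh hx
  refine ⟨fun n => ?_, mul_mul_self_mem_paravectors hh hx⟩
  induction n using Nat.twoStepInduction with
  | zero => simpa using hh
  | one => simpa using mul_mul_self_mem_paravectors hh hx
  | more n ih _ =>
    have key : (h * x) ^ (n + 2) * h = h * (x * ((h * x) ^ n * h) * x) * h := by
      rw [pow_succ, pow_succ']
      simp only [mul_assoc]
    rw [key]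
    exact mul_mul_self_mem_paravectors hh (mul_mul_self_mem_paravectors hx ih)
end

section
/- Fix N ∈ {1,2,3,4} and ℝ-linearly independent quaternions ω₁,…,ω_N; for k ∈ ℤ^N set w_k = 2(k₁ω₁ + ⋯ + k_Nω_N) and Λ = {w_k : k ∈ ℤ^N}. Then for every x ∈ ℍ with x ∉ Λ, the family indexed by k ∈ ℤ^N \ {0} given by (x − w_k)⁻¹ + Σ_{μ=0}^{N−1} (w_k⁻¹ x)^μ w_k⁻¹ is absolutely summable in ℍ (the family of its norms is summable). Consequently the Weierstrass zeta function ζ_N(x) = x⁻¹ + Σ_{k ∈ ℤ^N \ {0}} [ (x − w_k)⁻¹ + Σ_{μ=0}^{N−1} (w_k⁻¹ x)^μ w_k⁻¹ ] is well defined on ℍ \ Λ. -/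
noncomputable section

/-- The lattice vector `w_k = 2(k₁ω₁ + ⋯ + k_Nω_N)` in the quaternions. -/
def wk {N : ℕ} (ω : Fin N → Quaternion ℝ) (k : Fin N → ℤ) : Quaternion ℝ :=
  2 * ∑ i : Fin N, (k i : ℝ) • ω i

/-- The Weierstrass zeta function
`ζ_N(x) = x⁻¹ + Σ_{k ≠ 0} [ (x − w_k)⁻¹ + Σ_{μ=0}^{N−1} (w_k⁻¹x)^μ w_k⁻¹ ]`. -/
def zetaN {N : ℕ} (ω : Fin N → Quaternion ℝ) (x : Quaternion ℝ) : Quaternion ℝ :=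
  x⁻¹ + ∑' k : {k : Fin N → ℤ // k ≠ 0},
    ((x - wk ω k.1)⁻¹ +
      ∑ μ ∈ Finset.range N, ((wk ω k.1)⁻¹ * x) ^ μ * (wk ω k.1)⁻¹)

lemma summable_norm_inv_pow_span_basisFun {ι : Type*} [Fintype ι] {n : ℕ}
    (hn : Fintype.card ι < n) :
    Summable fun z : Submodule.span ℤ (Set.range (Pi.basisFun ℝ ι)) => ‖z‖⁻¹ ^ n := by
  apply ZLattice.summable_norm_pow_inv _ n
  rwa [Module.finrank_eq_card_basis ((Pi.basisFun ℝ ι).restrictScalars ℤ)]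

/-- The series `∑ ‖k‖⁻ⁿ` over the integer points of `ℝ^ι` converges as soon as `n` exceeds the
dimension. -/
lemma summable_norm_intCast_pi_inv_pow {ι : Type*} [Fintype ι] {n : ℕ}
    (hn : Fintype.card ι < n) :
    Summable fun k : ι → ℤ => ‖fun i => (k i : ℝ)‖⁻¹ ^ n := by
  have hmem (k : ι → ℤ) :
      (fun i => (k i : ℝ)) ∈ Submodule.span ℤ (Set.range (Pi.basisFun ℝ ι)) :=
    ((Pi.basisFun ℝ ι).mem_span_iff_repr_mem ℤ _).2 fun i => ⟨k i, by simp⟩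
  have hinj : Function.Injective fun k : ι → ℤ =>
      (⟨_, hmem k⟩ : Submodule.span ℤ (Set.range (Pi.basisFun ℝ ι))) := fun k l h =>
    funext fun i => Int.cast_injective (α := ℝ) (congrFun (congrArg Subtype.val h) i)
  have hsum := (summable_norm_inv_pow_span_basisFun hn).comp_injective hinj
  simpa only [Function.comp_def, Submodule.coe_norm] using hsum

/-- Subtracting from `(x - w)⁻¹` its expansion in powers of `w⁻¹ * x` leaves a single remainder
term. -/
lemma inv_sub_add_geom_sum {D : Type*} [DivisionRing D] {x w : D} (hw : w ≠ 0) (hxw : x ≠ w)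
    (n : ℕ) :
    (x - w)⁻¹ + ∑ μ ∈ Finset.range n, (w⁻¹ * x) ^ μ * w⁻¹ =
      (x - w)⁻¹ * w * (w⁻¹ * x) ^ n * w⁻¹ := by
  have h0 : x - w ≠ 0 := sub_ne_zero.2 hxw
  have hfac : x - w = w * (w⁻¹ * x - 1) := by
    rw [mul_sub, mul_inv_cancel_left₀ hw, mul_one]
  apply mul_left_cancel₀ h0
  calc (x - w) * ((x - w)⁻¹ + ∑ μ ∈ Finset.range n, (w⁻¹ * x) ^ μ * w⁻¹)
      = 1 + w * ((w⁻¹ * x - 1) * ∑ μ ∈ Finset.range n, (w⁻¹ * x) ^ μ) * w⁻¹ := by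
        rw [mul_add, mul_inv_cancel₀ h0, ← Finset.sum_mul, ← mul_assoc, ← mul_assoc w, ← hfac]
    _ = w * (w⁻¹ * x) ^ n * w⁻¹ := by
        rw [mul_geom_sum, mul_sub, sub_mul, mul_one, mul_inv_cancel₀ hw, add_sub_cancel]
    _ = (x - w) * ((x - w)⁻¹ * w * (w⁻¹ * x) ^ n * w⁻¹) := by
        simp only [mul_assoc, mul_inv_cancel_left₀ h0]

lemma norm_inv_sub_add_geom_sum_le {D : Type*} [NormedDivisionRing D] {x w : D} (hw : w ≠ 0)
    (hxw : 2 * ‖x‖ ≤ ‖w‖) (n : ℕ) :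
    ‖(x - w)⁻¹ + ∑ μ ∈ Finset.range n, (w⁻¹ * x) ^ μ * w⁻¹‖ ≤ 2 * ‖x‖ ^ n * ‖w‖⁻¹ ^ (n + 1) := by
  have hw' : 0 < ‖w‖ := norm_pos_iff.2 hw
  have hne : x ≠ w := by
    rintro rfl
    linarith
  have hsub : ‖w‖ / 2 ≤ ‖x - w‖ := by
    have := norm_sub_norm_le w x
    rw [norm_sub_rev] at this
    linarith
  have hratio : ‖x - w‖⁻¹ * ‖w‖ ≤ 2 := by
    rw [inv_mul_le_iff₀ (by linarith)]
    linarith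
  rw [inv_sub_add_geom_sum hw hne]
  simp only [norm_mul, norm_inv, norm_pow]
  calc ‖x - w‖⁻¹ * ‖w‖ * (‖w‖⁻¹ * ‖x‖) ^ n * ‖w‖⁻¹
      ≤ 2 * (‖w‖⁻¹ * ‖x‖) ^ n * ‖w‖⁻¹ := by gcongr
    _ = 2 * ‖x‖ ^ n * ‖w‖⁻¹ ^ (n + 1) := by ring

/-- The norm of a lattice vector is bounded below by a multiple of the norm of its coordinates. -/
lemma exists_norm_le_mul_norm_wk {N : ℕ} {ω : Fin N → Quaternion ℝ}
    (hω : LinearIndependent ℝ ω) :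
    ∃ K : ℝ, 0 < K ∧ ∀ k : Fin N → ℤ, ‖fun i => (k i : ℝ)‖ ≤ K * ‖wk ω k‖ := by
  obtain ⟨K, hK, h⟩ := (Fintype.linearCombination ℝ ω).exists_antilipschitzWith
    (LinearMap.ker_eq_bot.2 hω.fintypeLinearCombination_injective)
  refine ⟨K, hK, fun k => (ZeroHomClass.bound_of_antilipschitz _ h _).trans ?_⟩
  gcongr
  rw [Fintype.linearCombination_apply, wk, two_mul, ← two_smul ℝ, norm_smul]
  exact le_mul_of_one_le_left (norm_nonneg _) (by norm_num)

/-- For `x` off the lattice, the family of terms defining the Weierstrass zeta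
function `ζ_N` is absolutely summable; consequently `ζ_N` is well defined on the
complement of the lattice. -/
theorem zetaN_summable (N : ℕ) (hN1 : 1 ≤ N) (hN4 : N ≤ 4)
    (ω : Fin N → Quaternion ℝ) (hω : LinearIndependent ℝ ω)
    (x : Quaternion ℝ) (hx : x ∉ Set.range (wk ω)) :
    Summable (fun k : {k : Fin N → ℤ // k ≠ 0} =>
      ‖(x - wk ω k.1)⁻¹ +
        ∑ μ ∈ Finset.range N, ((wk ω k.1)⁻¹ * x) ^ μ * (wk ω k.1)⁻¹‖) := by
  obtain ⟨K, hK, hbound⟩ := exists_norm_le_mul_norm_wk hω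
  have hpos (k : {k : Fin N → ℤ // k ≠ 0}) : 0 < ‖fun i => (k.1 i : ℝ)‖ :=
    norm_pos_iff.2 fun h => k.2 <| funext fun i => by simpa using congrFun h i
  have hsum := ((summable_norm_intCast_pi_inv_pow (ι := Fin N) (n := N + 1)
    (by simp)).comp_injective (Subtype.val_injective (p := (· ≠ 0)))).mul_left (2 * ‖x‖ ^ N * K ^ (N + 1))
  refine Summable.of_norm_bounded_eventually hsum ?_
  have hfin : {k : Fin N → ℤ | ‖k‖ ≤ K * (2 * ‖x‖)}.Finite := by
    simpa [Metric.closedBall] using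
      (isCompact_closedBall (0 : Fin N → ℤ) (K * (2 * ‖x‖))).finite_of_discrete
  refine (hfin.preimage Subtype.val_injective.injOn).subset fun k hk => ?_
  by_contra hlarge
  apply hk
  have hnorm : ‖fun i => (k.1 i : ℝ)‖ = ‖k.1‖ := by
    simp only [Pi.norm_def, Int.norm_cast_real, nnnorm]
  have hKw := hbound k.1
  have hw : 0 < ‖wk ω k.1‖ := pos_of_mul_pos_right ((hpos k).trans_le hKw) hK.le
  have hxw : 2 * ‖x‖ ≤ ‖wk ω k.1‖ := by
    have : K * (2 * ‖x‖) < ‖k.1‖ := not_le.1 hlarge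
    exact le_of_mul_le_mul_left (by linarith) hK
  have hinv : ‖wk ω k.1‖⁻¹ ≤ K * ‖fun i => (k.1 i : ℝ)‖⁻¹ := by
    rw [← div_eq_mul_inv, inv_le_iff_one_le_mul₀ hw, div_mul_eq_mul_div, one_le_div (hpos k)]
    exact hKw
  refine (norm_norm _).trans_le ?_
  calc _ ≤ 2 * ‖x‖ ^ N * ‖wk ω k.1‖⁻¹ ^ (N + 1) :=
        norm_inv_sub_add_geom_sum_le (norm_pos_iff.1 hw) hxw N
    _ ≤ 2 * ‖x‖ ^ N * (K * ‖fun i => (k.1 i : ℝ)‖⁻¹) ^ (N + 1) := by gcongr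
    _ = _ := by
        rw [mul_pow, ← mul_assoc]
        rfl

end
end

section
/- Fix N ∈ {1,2,3,4} and ℝ-linearly independent quaternions ω₁,…,ω_N, with lattice Λ = {w_k : k ∈ ℤ^N}, w_k = 2(k₁ω₁ + ⋯ + k_Nω_N), and let ζ_N be the associated Weierstrass zeta function. If x ∈ ℍ satisfies 2‖x‖ < ‖w_k‖ for all k ∈ ℤ^N \ {0} and x ≠ 0, then ζ_N(x) = x⁻¹ − Σ_{k ∈ ℤ^N \ {0}} ( Σ_{n=N}^{∞} (w_k⁻¹ x)^n w_k⁻¹ ), where for each k the inner series converges absolutely and the outer family is absolutely summable. -/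
noncomputable section

open Finset in
/-- The tail of a geometric series in a normed division ring. -/
lemma hasSum_pow_add_mul_inv {K : Type*} [NormedDivisionRing K] {w x : K} (h : ‖x‖ < ‖w‖) (N : ℕ) :
    HasSum (fun n : ℕ => (w⁻¹ * x) ^ (N + n) * w⁻¹)
      (-((x - w)⁻¹ + ∑ μ ∈ range N, (w⁻¹ * x) ^ μ * w⁻¹)) := by
  have hw : 0 < ‖w‖ := (norm_nonneg x).trans_lt h
  have hw0 : w ≠ 0 := norm_pos_iff.mp hw
  have hq : ‖w⁻¹ * x‖ < 1 := by
    rw [norm_mul, norm_inv, inv_mul_lt_one₀ hw]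
    exact h
  have hinv : (1 - w⁻¹ * x)⁻¹ * w⁻¹ = -(x - w)⁻¹ := by
    rw [← mul_inv_rev, mul_sub, mul_one, mul_inv_cancel_left₀ hw0, ← inv_neg, neg_sub]
  have hsum := (hasSum_geometric_of_norm_lt_one hq).mul_right w⁻¹
  rw [hinv, ← hasSum_nat_add_iff' N] at hsum
  simpa only [add_comm _ N, neg_add, sub_eq_add_neg] using hsum

lemma norm_pow_mul_inv {K : Type*} [NormedDivisionRing K] (w x : K) (n : ℕ) :
    ‖(w⁻¹ * x) ^ n * w⁻¹‖ = (‖x‖ / ‖w‖) ^ n * ‖w‖⁻¹ := by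
  rw [norm_mul, norm_pow, norm_mul, norm_inv, div_eq_inv_mul]

lemma summable_norm_pow_add_mul_inv {K : Type*} [NormedDivisionRing K] {w x : K}
    (h : ‖x‖ < ‖w‖) (N : ℕ) :
    Summable (fun n : ℕ => ‖(w⁻¹ * x) ^ (N + n) * w⁻¹‖) := by
  have hq : ‖x‖ / ‖w‖ < 1 := (div_lt_one ((norm_nonneg x).trans_lt h)).2 h
  simp_rw [norm_pow_mul_inv]
  simp only [pow_add]
  exact ((summable_geometric_of_lt_one (by positivity) hq).mul_left _).mul_right _

lemma norm_tsum_pow_add_mul_inv_le {K : Type*} [NormedDivisionRing K] {w x : K}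
    (h : 2 * ‖x‖ < ‖w‖) (N : ℕ) :
    ‖∑' n : ℕ, (w⁻¹ * x) ^ (N + n) * w⁻¹‖ ≤ 2 * ‖x‖ ^ N * ‖w‖⁻¹ ^ (N + 1) := by
  have hw : 0 < ‖w‖ := (by positivity : 0 ≤ 2 * ‖x‖).trans_lt h
  have hq : ‖x‖ / ‖w‖ ≤ 1 / 2 := by
    rw [div_le_iff₀ hw]
    linarith
  have hbound := (hasSum_geometric_two.mul_left ((‖x‖ / ‖w‖) ^ N)).mul_right ‖w‖⁻¹
  refine (tsum_of_norm_bounded hbound fun n => ?_).trans_eq ?_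
  · rw [norm_pow_mul_inv, pow_add]
    gcongr
  · rw [div_eq_mul_inv, mul_pow]
    ring

/-- Over `ℤ^N`, the series `∑ ‖k‖⁻ⁿ` converges for `n > N`. -/
lemma summable_norm_intCast_inv_pow {ι : Type*} [Fintype ι] {n : ℕ} (hn : Fintype.card ι < n) :
    Summable (fun k : ι → ℤ => ‖fun i => (k i : ℝ)‖⁻¹ ^ n) := by
  have hL : Module.finrank ℤ (Submodule.span ℤ (Set.range (Pi.basisFun ℝ ι))) < n :=
    (finrank_range_le_card (R := ℤ) (Pi.basisFun ℝ ι)).trans_lt hn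
  have hmem (k : ι → ℤ) :
      (fun i => (k i : ℝ)) ∈ Submodule.span ℤ (Set.range (Pi.basisFun ℝ ι)) := by
    rw [Module.Basis.mem_span_iff_repr_mem]
    intro i
    simp
  have hinj : Function.Injective fun k : ι → ℤ =>
      (⟨_, hmem k⟩ : Submodule.span ℤ (Set.range (Pi.basisFun ℝ ι))) := fun a b hab =>
    funext fun i => Int.cast_injective (α := ℝ) (congrFun (congrArg Subtype.val hab) i)
  exact ((ZLattice.summable_norm_pow_inv _ n hL).comp_injective hinj).congr fun _ => rfl

lemma LinearIndependent.exists_norm_le_norm_wk {N : ℕ} {ω : Fin N → Quaternion ℝ}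
    (hω : LinearIndependent ℝ ω) :
    ∃ C : ℝ, 0 < C ∧ ∀ k : Fin N → ℤ, ‖fun i => (k i : ℝ)‖ ≤ C * ‖wk ω k‖ := by
  obtain ⟨C, hC, hanti⟩ := (Fintype.linearCombination ℝ ω).exists_antilipschitzWith
    (LinearMap.ker_eq_bot.2 hω.fintypeLinearCombination_injective)
  refine ⟨C, hC, fun k => ?_⟩
  have h := hanti.le_mul_norm (map_zero _) (fun i => (k i : ℝ))
  rw [Fintype.linearCombination_apply] at h
  refine h.trans ?_
  rw [wk, two_mul, ← two_smul ℝ, norm_smul, Real.norm_ofNat]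
  gcongr
  linarith [norm_nonneg (∑ i : Fin N, (k i : ℝ) • ω i)]

lemma summable_norm_wk_inv_pow {N : ℕ} {ω : Fin N → Quaternion ℝ}
    (hω : LinearIndependent ℝ ω) {n : ℕ} (hn : N < n) :
    Summable (fun k : {k : Fin N → ℤ // k ≠ 0} => ‖wk ω k.1‖⁻¹ ^ n) := by
  obtain ⟨C, hC, hle⟩ := hω.exists_norm_le_norm_wk
  have hsum : Summable (fun k : Fin N → ℤ => ‖fun i => (k i : ℝ)‖⁻¹ ^ n) :=
    summable_norm_intCast_inv_pow (by simpa using hn)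
  refine Summable.of_nonneg_of_le (fun k => by positivity) (fun k => ?_)
    ((hsum.comp_injective Subtype.val_injective).mul_left (C ^ n))
  have hk : 0 < ‖fun i => ((k.1 i : ℤ) : ℝ)‖ := by
    refine norm_pos_iff.2 fun h0 => k.2 (funext fun i => ?_)
    simpa using congrFun h0 i
  rw [Function.comp_apply, ← mul_pow]
  gcongr
  rw [← div_eq_mul_inv, ← inv_div]
  gcongr
  rw [div_le_iff₀' hC]
  exact hle k.1

/-- The paper's expansion (2): for `x ≠ 0` with `2‖x‖ < ‖w_k‖` for every nonzero
lattice vector `w_k`, `ζ_N(x) = x⁻¹ − Σ_{k ≠ 0} Σ_{n=N}^{∞} (w_k⁻¹x)^n w_k⁻¹`,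
with the inner series absolutely convergent and the outer family absolutely
summable. -/
theorem zetaN_expansion (N : ℕ) (hN1 : 1 ≤ N) (hN4 : N ≤ 4)
    (ω : Fin N → Quaternion ℝ) (hω : LinearIndependent ℝ ω)
    (x : Quaternion ℝ) (hx0 : x ≠ 0)
    (hx : ∀ k : Fin N → ℤ, k ≠ 0 → 2 * ‖x‖ < ‖wk ω k‖) :
    (∀ k : {k : Fin N → ℤ // k ≠ 0},
      Summable (fun n : ℕ => ‖((wk ω k.1)⁻¹ * x) ^ (N + n) * (wk ω k.1)⁻¹‖)) ∧
    Summable (fun k : {k : Fin N → ℤ // k ≠ 0} =>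
      ‖∑' n : ℕ, ((wk ω k.1)⁻¹ * x) ^ (N + n) * (wk ω k.1)⁻¹‖) ∧
    zetaN ω x = x⁻¹ - ∑' k : {k : Fin N → ℤ // k ≠ 0},
      ∑' n : ℕ, ((wk ω k.1)⁻¹ * x) ^ (N + n) * (wk ω k.1)⁻¹ := by
  have hlt : ∀ k : {k : Fin N → ℤ // k ≠ 0}, ‖x‖ < ‖wk ω k.1‖ := fun k => by
    linarith [hx k.1 k.2, norm_nonneg x]
  refine ⟨fun k => summable_norm_pow_add_mul_inv (hlt k) N, ?_, ?_⟩
  · exact Summable.of_nonneg_of_le (fun k => norm_nonneg _)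
      (fun k => norm_tsum_pow_add_mul_inv_le (hx k.1 k.2) N)
      ((summable_norm_wk_inv_pow hω N.lt_succ_self).mul_left _)
  · simp only [fun k => (hasSum_pow_add_mul_inv (hlt k) N).tsum_eq]
    rw [tsum_neg, sub_neg_eq_add, zetaN]

end
end

section
/- Let x ∈ ℍ be a nonzero quaternion, let h ∈ ℍ, and let q ∈ ℕ. Then the q-th iterated Fréchet derivative of the inversion map y ↦ y⁻¹ at x, evaluated at (h, h, …, h) (q copies), equals (−1)^q · q! · (x⁻¹ h)^q · x⁻¹. -/
section InverseDerivatives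

variable {𝕜 R : Type*} [NontriviallyNormedField 𝕜] [NormedDivisionRing R] [NormedAlgebra 𝕜 R]

theorem differentiableAt_inv_mul_pow_mul_inv {x : R} (hx : x ≠ 0) (h : R) (q : ℕ) :
    DifferentiableAt 𝕜 (fun y : R => (y⁻¹ * h) ^ q * y⁻¹) x :=
  (((differentiableAt_inv hx).mul_const h).pow q).mul (differentiableAt_inv hx)

/-- The derivative of `y ↦ (y⁻¹ * h) ^ q * y⁻¹` in the direction `h`. -/
theorem fderiv_inv_mul_pow_mul_inv_apply {x : R} (hx : x ≠ 0) (h : R) (q : ℕ) :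
    fderiv 𝕜 (fun y : R => (y⁻¹ * h) ^ q * y⁻¹) x h =
      -((q + 1 : 𝕜) • ((x⁻¹ * h) ^ (q + 1) * x⁻¹)) := by
  induction q with
  | zero => simp [fderiv_inv' hx]
  | succ q ih =>
    have hinv : HasFDerivAt (fun y : R => y⁻¹ * h) _ x :=
      (hasFDerivAt_inv' (𝕜 := 𝕜) hx).mul_const' h
    have hmul := hinv.mul' (differentiableAt_inv_mul_pow_mul_inv (𝕜 := 𝕜) hx h q).hasFDerivAt
    have hfun : (fun y : R => (y⁻¹ * h) ^ (q + 1) * y⁻¹) =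
        fun y => y⁻¹ * h * ((y⁻¹ * h) ^ q * y⁻¹) := by
      funext y
      rw [pow_succ', mul_assoc]
    rw [hfun]
    change fderiv 𝕜 ((fun y : R => y⁻¹ * h) * fun y => (y⁻¹ * h) ^ q * y⁻¹) x h = _
    rw [hmul.fderiv]
    simp [ih, pow_succ', add_smul, mul_add, mul_assoc]
    abel

/-- The iterated derivatives of inversion in a normed division algebra, along the diagonal. -/
theorem iteratedFDeriv_inv_apply_const {x : R} (hx : x ≠ 0) (h : R) (q : ℕ) :
    iteratedFDeriv 𝕜 q (fun y : R => y⁻¹) x (fun _ => h) =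
      ((-1 : 𝕜) ^ q * q.factorial) • ((x⁻¹ * h) ^ q * x⁻¹) := by
  induction q generalizing x with
  | zero => simp
  | succ q ih =>
    have hcont : ContDiffAt 𝕜 (q + 1 : ℕ) (fun y : R => y⁻¹) x := by
      simpa only [Ring.inverse_eq_inv'] using! contDiffAt_ringInverse 𝕜 (Units.mk0 x hx)
    have hdiff := hcont.differentiableAt_iteratedFDeriv (m := q) (by exact_mod_cast q.lt_succ_self)
    have heq : (fun y : R => iteratedFDeriv 𝕜 q (fun z : R => z⁻¹) y fun _ => h) =ᶠ[nhds x]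
        fun y => ((-1 : 𝕜) ^ q * q.factorial) • ((y⁻¹ * h) ^ q * y⁻¹) :=
      (isOpen_ne.eventually_mem hx).mono fun y hy => ih hy
    rw [hdiff.iteratedFDeriv_succ_apply_left']
    change fderiv 𝕜 (fun y : R => iteratedFDeriv 𝕜 q (fun z : R => z⁻¹) y fun _ => h) x h = _
    rw [heq.fderiv_eq, fderiv_fun_const_smul (differentiableAt_inv_mul_pow_mul_inv hx h q),
      smul_apply, fderiv_inv_mul_pow_mul_inv_apply hx, smul_neg, smul_smul,
      ← neg_smul, Nat.factorial_succ]
    congr 1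
    push_cast
    ring

end InverseDerivatives

/-- The identity `(h|∇)^q (x⁻¹) = (−1)^q q! (x⁻¹h)^q x⁻¹` for iterated directional
derivatives of the quaternionic inversion map. -/
theorem iteratedFDeriv_inv_quaternion (x : Quaternion ℝ) (hx : x ≠ 0)
    (h : Quaternion ℝ) (q : ℕ) :
    (iteratedFDeriv ℝ q (fun y : Quaternion ℝ => y⁻¹) x) (fun _ => h) =
      ((-1 : ℝ) ^ q * q.factorial) • ((x⁻¹ * h) ^ q * x⁻¹) :=
  iteratedFDeriv_inv_apply_const hx h q
end

section
/- Let ω₁ be a nonzero quaternion, let Λ = {2k₁ω₁ : k₁ ∈ ℤ}, and let ζ₁ be the associated Weierstrass zeta function, ζ₁(x) = x⁻¹ + Σ_{k₁ ∈ ℤ \ {0}} [ (x − 2k₁ω₁)⁻¹ + (2k₁ω₁)⁻¹ ] for x ∉ Λ. Then ζ₁ is exactly periodic: for every x ∈ ℍ with x ∉ Λ, ζ₁(x + 2ω₁) = ζ₁(x). -/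
noncomputable section

/-- The Weierstrass zeta function `ζ₁` with half-period `ω`:
`ζ₁(x) = x⁻¹ + Σ_{k ≠ 0} [ (x − 2kω)⁻¹ + (2kω)⁻¹ ]`. -/
def zeta1 (ω : Quaternion ℝ) (x : Quaternion ℝ) : Quaternion ℝ :=
  x⁻¹ + ∑' k : {k : ℤ // k ≠ 0}, ((x - (2 * k.1) • ω)⁻¹ + ((2 * k.1) • ω)⁻¹)

/-- The series over all of `ℤ`; since `0⁻¹ = 0`, its term at `k = 0` is the leading term `x⁻¹`. -/
theorem summable_zeta1_term (ω : Quaternion ℝ) (hω : ω ≠ 0) (x : Quaternion ℝ) :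
    Summable fun k : ℤ => (x - (2 * k) • ω)⁻¹ + ((2 * k) • ω)⁻¹ := by
  have hω' : 0 < ‖ω‖ := norm_pos_iff.2 hω
  have hsum : Summable fun k : ℤ => (1 : ℝ) / (k : ℝ) ^ 2 :=
    Real.summable_one_div_int_pow.2 one_lt_two
  refine summable_of_isBigO hsum (Asymptotics.IsBigO.of_bound (‖x‖ / (2 * ‖ω‖ ^ 2)) ?_)
  have hlarge : ∀ᶠ k : ℤ in Filter.cofinite, ‖x‖ / ‖ω‖ + 1 ≤ ‖k‖ := by
    have h := tendsto_norm_cocompact_atTop (E := ℤ)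
    rw [Filter.cocompact_eq_cofinite] at h
    exact h.eventually_ge_atTop _
  filter_upwards [hlarge] with k hk
  rw [Int.norm_eq_abs] at hk
  have hk0 : 0 < |(k : ℝ)| := lt_of_lt_of_le (by positivity) hk
  have hxk : ‖x‖ ≤ |(k : ℝ)| * ‖ω‖ := by
    rw [← div_le_iff₀ hω']
    linarith
  have hna : ‖(2 * k) • ω‖ = 2 * (|(k : ℝ)| * ‖ω‖) := by
    rw [norm_zsmul ℝ]
    simp [mul_assoc]
  have hpos : 0 < |(k : ℝ)| * ‖ω‖ := mul_pos hk0 hω'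
  have hnd : |(k : ℝ)| * ‖ω‖ ≤ ‖x - (2 * k) • ω‖ := by
    have h := norm_sub_norm_le ((2 * k) • ω) x
    rw [norm_sub_rev] at h
    linarith
  have ha : (2 * k) • ω ≠ 0 := norm_pos_iff.1 (by rw [hna]; positivity)
  have hd : x - (2 * k) • ω ≠ 0 := norm_pos_iff.1 (hpos.trans_le hnd)
  have hfactor : (x - (2 * k) • ω)⁻¹ + ((2 * k) • ω)⁻¹ =
      (x - (2 * k) • ω)⁻¹ * x * ((2 * k) • ω)⁻¹ := by
    rw [inv_add_inv' hd ha, sub_add_cancel]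
  rw [hfactor, norm_mul, norm_mul, norm_inv, norm_inv, hna]
  calc ‖x - (2 * k) • ω‖⁻¹ * ‖x‖ * (2 * (|(k : ℝ)| * ‖ω‖))⁻¹
      ≤ (|(k : ℝ)| * ‖ω‖)⁻¹ * ‖x‖ * (2 * (|(k : ℝ)| * ‖ω‖))⁻¹ := by gcongr
    _ = ‖x‖ / (2 * ‖ω‖ ^ 2) * ‖(1 : ℝ) / (k : ℝ) ^ 2‖ := by
      rw [norm_div, norm_one, norm_pow, Real.norm_eq_abs]
      field_simp

theorem zeta1_eq_tsum (ω : Quaternion ℝ) (hω : ω ≠ 0) (x : Quaternion ℝ) :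
    zeta1 ω x = ∑' k : ℤ, ((x - (2 * k) • ω)⁻¹ + ((2 * k) • ω)⁻¹) := by
  rw [← (summable_zeta1_term ω hω x).tsum_subtype_add_tsum_subtype_compl {0},
    tsum_singleton (0 : ℤ) fun k : ℤ => (x - (2 * k) • ω)⁻¹ + ((2 * k) • ω)⁻¹]
  simp only [mul_zero, zero_smul, sub_zero, inv_zero, add_zero]
  rfl

theorem tendsto_inv_sub_zsmul_cofinite (ω : Quaternion ℝ) (hω : ω ≠ 0) (x : Quaternion ℝ) :
    Filter.Tendsto (fun k : ℤ => (x - (2 * k) • ω)⁻¹) Filter.cofinite (nhds 0) := by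
  have h₁ := (summable_zeta1_term ω hω x).tendsto_cofinite_zero
  have h₂ := (summable_zeta1_term ω hω 0).tendsto_cofinite_zero
  have hω' : 0 < ‖ω‖ := norm_pos_iff.2 hω
  have h₃ : Filter.Tendsto (fun k : ℤ => ((2 * k) • ω)⁻¹) Filter.cofinite (nhds 0) := by
    refine Filter.tendsto_inv₀_cobounded.comp (tendsto_norm_atTop_iff_cobounded.1 ?_)
    have h := tendsto_norm_cocompact_atTop (E := ℤ)
    rw [Filter.cocompact_eq_cofinite] at h
    refine (h.atTop_mul_const (mul_pos two_pos hω')).congr fun k => ?_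
    rw [norm_zsmul ℝ, Int.norm_eq_abs]
    simp
    ring
  simpa using h₁.sub h₃

/-- A summable telescoping series over `ℤ` whose primitive vanishes at infinity has sum `0`. -/
theorem tsum_int_sub_pred_eq_zero {E : Type*} [AddCommGroup E] [TopologicalSpace E]
    [IsTopologicalAddGroup E] [T2Space E] {h : ℤ → E}
    (hs : Summable fun k : ℤ => h (k - 1) - h k)
    (ht : Filter.Tendsto h Filter.cofinite (nhds 0)) :
    ∑' k : ℤ, (h (k - 1) - h k) = 0 := by
  have hpart : ∀ n : ℕ, ∑ k ∈ Finset.Ico (-(n : ℤ)) n, (h (k - 1) - h k) =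
      h (-(n : ℤ) - 1) - h ((n : ℤ) - 1) := by
    intro n
    induction n with
    | zero => simp
    | succ n ih =>
      have hset : Finset.Ico (-((n + 1 : ℕ) : ℤ)) ((n + 1 : ℕ) : ℤ) =
          insert (-(n : ℤ) - 1) (insert (n : ℤ) (Finset.Ico (-(n : ℤ)) n)) := by
        ext k
        simp only [Finset.mem_Ico, Finset.mem_insert]
        omega
      rw [hset, Finset.sum_insert (by simp), Finset.sum_insert (by simp), ih]
      have h₁ : -((n + 1 : ℕ) : ℤ) - 1 = -(n : ℤ) - 1 - 1 := by push_cast; ring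
      have h₂ : ((n + 1 : ℕ) : ℤ) - 1 = n := by push_cast; ring
      rw [h₁, h₂]
      abel
  have hlim := hs.hasSum.comp (Finset.tendsto_Ico_neg (R := ℤ))
  have hinj₁ : Function.Injective fun n : ℕ => -(n : ℤ) - 1 := fun a b hab => by
    simpa using hab
  have hinj₂ : Function.Injective fun n : ℕ => (n : ℤ) - 1 := fun a b hab => by
    simpa using hab
  have h₁ := ht.comp hinj₁.tendsto_cofinite
  have h₂ := ht.comp hinj₂.tendsto_cofinite
  rw [Nat.cofinite_eq_atTop] at h₁ h₂
  have h₃ := h₁.sub h₂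
  rw [sub_zero] at h₃
  exact tendsto_nhds_unique hlim (h₃.congr fun n => (hpart n).symm)

/-- `ζ₁` is exactly periodic: `ζ₁(x + 2ω) = ζ₁(x)` for `x` off the lattice
`{2kω : k ∈ ℤ}`. -/
theorem zeta1_periodic (ω : Quaternion ℝ) (hω : ω ≠ 0)
    (x : Quaternion ℝ) (hx : x ∉ {y : Quaternion ℝ | ∃ k : ℤ, y = (2 * k) • ω}) :
    zeta1 ω (x + 2 • ω) = zeta1 ω x := by
  have hs := summable_zeta1_term ω hω x
  have hs' := summable_zeta1_term ω hω (x + 2 • ω)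
  have hterm : ∀ k : ℤ, ((x + 2 • ω - (2 * k) • ω)⁻¹ + ((2 * k) • ω)⁻¹) -
      ((x - (2 * k) • ω)⁻¹ + ((2 * k) • ω)⁻¹) =
      (x - (2 * (k - 1)) • ω)⁻¹ - (x - (2 * k) • ω)⁻¹ := by
    intro k
    have hshift : x + 2 • ω - (2 * k) • ω = x - (2 * (k - 1)) • ω := by module
    rw [hshift, add_sub_add_right_eq_sub]
  rw [zeta1_eq_tsum ω hω, zeta1_eq_tsum ω hω, ← sub_eq_zero, ← hs'.tsum_sub hs,
    tsum_congr hterm]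
  exact tsum_int_sub_pred_eq_zero (h := fun k : ℤ => (x - (2 * k) • ω)⁻¹)
    ((hs'.sub hs).congr hterm) (tendsto_inv_sub_zsmul_cofinite ω hω x)

end
end
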